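/- Let K be a field and let 𝒜 be a non-unital, not necessarily associative algebra over K with elements e, f, g ∈ 𝒜 and scalars i, j, k ∈ K satisfying e·e = i•e, f·f = j•f, g·g = k•g. Set A = e·f, B = e·g, C = f·e, D = f·g, E = g·e, F = g·f. If (x·y)·(x·y) = (x·x)·(y·y) holds for all x, y ∈ 𝒜, then: E·E = (i*k)•E; F·F = (j*k)•F; E·F + F·E = k•(g·(A+C)); k•(E·g) = k•(g·B); and k•(F·g) = k•(g·D). -/

import Mathlib

/-- Polarization of the endo-commutativity identity in its second variable. -/
theorem endoCommutative_polarization {R : Type*} [NonUnitalNonAssocRing R]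
    (hec : ∀ x y : R, (x * y) * (x * y) = (x * x) * (y * y)) (x y z : R) :
    (x * y) * (x * z) + (x * z) * (x * y) = (x * x) * (y * z + z * y) := by
  have h := hec x (y + z)
  simp only [mul_add, add_mul] at h ⊢
  rw [hec x y, hec x z] at h
  rw [← sub_eq_zero] at h ⊢
  rw [← h]
  abel

/-- In an endo-commutative algebra, an element `x` with `x * x = k • x` satisfies
`k • ((x * y) * x) = k • (x * (y * x))`. -/
theorem endoCommutative_smul_flexible {K R : Type*} [Field K] [NonUnitalNonAssocRing R]
    [Module K R] [SMulCommClass K R R] [IsScalarTower K R R]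
    (hec : ∀ x y : R, (x * y) * (x * y) = (x * x) * (y * y)) {x : R} {k : K}
    (hx : x * x = k • x) (y : R) :
    k • ((x * y) * x) = k • (x * (y * x)) := by
  have h := endoCommutative_polarization hec x y x
  rw [hx] at h
  simp only [mul_add, smul_mul_assoc, mul_smul_comm] at h
  exact add_right_cancel h

/-- The five equations obtained by substituting x = g into the endo-commutativity identity (equation (6)). -/
theorem eq_system_six
    (K : Type*) [Field K] (𝒜 : Type*) [NonUnitalNonAssocRing 𝒜]
    [Module K 𝒜] [SMulCommClass K 𝒜 𝒜] [IsScalarTower K 𝒜 𝒜]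
    (e f g : 𝒜) (i j k : K)
    (he : e * e = i • e) (hf : f * f = j • f) (hg : g * g = k • g)
    (A B C D E F : 𝒜)
    (hA : A = e * f) (hB : B = e * g) (hC : C = f * e)
    (hD : D = f * g) (hE : E = g * e) (hF : F = g * f)
    (hec : ∀ x y : 𝒜, (x * y) * (x * y) = (x * x) * (y * y)) :
    E * E = (i * k) • E ∧
    F * F = (j * k) • F ∧
    E * F + F * E = k • (g * (A + C)) ∧
    k • (E * g) = k • (g * B) ∧
    k • (F * g) = k • (g * D) := by
  subst hA hB hC hD hE hF
  refine ⟨?_, ?_, ?_, endoCommutative_smul_flexible hec hg e,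
    endoCommutative_smul_flexible hec hg f⟩
  · rw [hec, hg, he, smul_mul_assoc, mul_smul_comm, smul_smul, mul_comm]
  · rw [hec, hg, hf, smul_mul_assoc, mul_smul_comm, smul_smul, mul_comm]
  · rw [endoCommutative_polarization hec, hg, smul_mul_assoc]
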